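/- For every positive integer r and every integer n ≥ 2, in ℤ[q] one has ∑_{σ ∈ K_{r,n}} q^{exc^Clr(σ)} (−1)^{cyc(σ)} = 0, where K_{r,n} = {σ = (z,τ) ∈ G_{r,n} : τ(n) ≠ n and τ(n−1) ≠ n}. -/

import Mathlib

open Finset Polynomial

/-- Number of excedances of a permutation: #{i : τ(i) > i}. -/
def exc {n : ℕ} (τ : Equiv.Perm (Fin n)) : ℕ :=
  (Finset.univ.filter fun i => i < τ i).card

/-- Number of cycles of a permutation, counting fixed points as cycles. -/
def cyc {n : ℕ} (τ : Equiv.Perm (Fin n)) : ℕ :=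
  Multiset.card τ.cycleType + (Finset.univ.filter fun i => τ i = i).card

/-- Color sum of a colored permutation. -/
def csum {r n : ℕ} (z : Fin n → Fin r) : ℕ := ∑ i, (z i : ℕ)

/-- #{i : z_i = 0 and τ(i) > i}. -/
def excA {r n : ℕ} (z : Fin n → Fin r) (τ : Equiv.Perm (Fin n)) : ℕ :=
  (Finset.univ.filter fun i => (z i : ℕ) = 0 ∧ i < τ i).card

/-- Excedance number with respect to the absolute order. -/
def excAbs {r n : ℕ} (z : Fin n → Fin r) (τ : Equiv.Perm (Fin n)) : ℕ :=
  exc τ + csum z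

/-- Excedance number with respect to the color order. -/
def excClr {r n : ℕ} (z : Fin n → Fin r) (τ : Equiv.Perm (Fin n)) : ℕ :=
  r * excA z τ + csum z

open Equiv.Perm in
theorem neg_one_pow_cyc {R : Type*} [CommRing R] {n : ℕ} (τ : Equiv.Perm (Fin n)) :
    (-1 : R) ^ cyc τ = (-1) ^ n * ((sign τ : ℤ) : R) := by
  have hn : n = τ.support.card + (Finset.univ.filter fun i => τ i = i).card := by
    have h := Finset.card_filter_add_card_filter_not
      (s := (Finset.univ : Finset (Fin n))) (fun i => τ i ≠ i)
    simp only [not_not, Finset.card_univ, Fintype.card_fin] at h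
    exact h.symm
  have hs : ((sign τ : ℤ) : R) = (-1) ^ (τ.support.card + Multiset.card τ.cycleType) := by
    rw [sign_of_cycleType, sum_cycleType]
    push_cast
    rfl
  rw [hs, ← pow_add]
  apply neg_one_pow_congr
  rw [cyc]
  generalize Multiset.card τ.cycleType = c at *
  generalize τ.support.card = s at *
  generalize (Finset.univ.filter fun i => τ i = i).card = f at *
  subst hn
  simp only [Nat.even_iff]
  omega

theorem neg_one_pow_cyc_mul_swap {R : Type*} [CommRing R] {n : ℕ} (τ : Equiv.Perm (Fin n))
    {a b : Fin n} (hab : a ≠ b) :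
    (-1 : R) ^ cyc (τ * Equiv.swap a b) = -(-1) ^ cyc τ := by
  simp [neg_one_pow_cyc, Equiv.Perm.sign_swap hab]

theorem excClr_mul_swap {r n : ℕ} (z : Fin n → Fin r) (τ : Equiv.Perm (Fin n)) {a b : Fin n}
    (haa : τ a ≤ a) (hab : τ a ≤ b) (hba : τ b ≤ a) (hbb : τ b ≤ b) :
    excClr z (τ * Equiv.swap a b) = excClr z τ := by
  have h (i : Fin n) : i < (τ * Equiv.swap a b) i ↔ i < τ i := by
    rw [Equiv.Perm.mul_apply]
    rcases eq_or_ne i a with rfl | hia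
    · simp [hba.not_gt, haa.not_gt]
    rcases eq_or_ne i b with rfl | hib
    · simp [hab.not_gt, hbb.not_gt]
    rw [Equiv.swap_apply_of_ne_of_ne hia hib]
  simp only [excClr, excA, h]

theorem stmt16 (r n : ℕ) (hr : 0 < r) (hn : 2 ≤ n) :
    ∑ σ ∈ Finset.univ.filter
        (fun σ : (Fin n → Fin r) × Equiv.Perm (Fin n) =>
          σ.2 ⟨n - 1, by omega⟩ ≠ ⟨n - 1, by omega⟩ ∧
          σ.2 ⟨n - 2, by omega⟩ ≠ ⟨n - 1, by omega⟩),
      (X : Polynomial ℤ) ^ excClr σ.1 σ.2 * (-1) ^ cyc σ.2 = 0 := by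
  set a : Fin n := ⟨n - 1, by omega⟩ with ha
  set b : Fin n := ⟨n - 2, by omega⟩ with hb
  have hab : a ≠ b := by simp only [ha, hb, ne_eq, Fin.mk.injEq]; omega
  have le_a (i : Fin n) : i ≤ a := by rw [Fin.le_def, ha]; dsimp only; omega
  have le_b (i : Fin n) (hi : i ≠ a) : i ≤ b := by
    rw [ne_eq, Fin.ext_iff, ha] at hi
    rw [Fin.le_def, hb]
    dsimp only at *
    omega
  refine Finset.sum_involution (fun σ _ => (σ.1, σ.2 * Equiv.swap a b)) ?_ ?_ ?_ ?_
  · rintro ⟨z, τ⟩ h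
    obtain ⟨h₁, h₂⟩ := (Finset.mem_filter.mp h).2
    dsimp only at *
    rw [neg_one_pow_cyc_mul_swap τ hab,
      excClr_mul_swap z τ (le_a _) (le_b _ h₁) (le_a _) (le_b _ h₂)]
    ring
  · rintro ⟨z, τ⟩ _ _ h
    exact hab (Equiv.swap_eq_one_iff.mp (mul_eq_left.mp (congrArg Prod.snd h)))
  · rintro ⟨z, τ⟩ h
    simpa [and_comm] using h
  · rintro ⟨z, τ⟩ _
    simp [mul_assoc]
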